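/- Let R be an integral domain, Y a Stone space, f : Y → Σ(R) continuous with respect to the Zariski topology, and A = {a ∈ LocallyConstant(Y, R) : a(y) ∈ f(y) for all y ∈ Y} the patch algebra of the patch bundle f. Then an ideal p of A is a minimal prime ideal of A if and only if there exists y ∈ Y such that p = {a ∈ A : a(y) = 0}. -/

import Mathlib

/-- The Zariski topology on the set of subrings of a commutative ring `R`,
generated by the sets `{S | r ∈ S}` for `r ∈ R`. -/
instance zariskiTopology (R : Type*) [CommRing R] : TopologicalSpace (Subring R) :=
  TopologicalSpace.generateFrom {U : Set (Subring R) | ∃ r : R, U = {S : Subring R | r ∈ S}}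

/-- The patch algebra of a family `f` of subrings of `R` indexed by a topological
space `Y`: the subring of `LocallyConstant Y R` consisting of the locally constant
functions `a` with `a y ∈ f y` for all `y`. -/
def patchAlgebra (Y : Type*) [TopologicalSpace Y] (R : Type*) [CommRing R]
    (f : Y → Subring R) : Subring (LocallyConstant Y R) where
  carrier := {a : LocallyConstant Y R | ∀ y : Y, a y ∈ f y}
  zero_mem' := fun y => by simpa using zero_mem (f y)
  one_mem' := fun y => by simpa using one_mem (f y)
  add_mem' := fun {a b} ha hb y => by simpa using add_mem (ha y) (hb y)
  mul_mem' := fun {a b} ha hb y => by simpa using mul_mem (ha y) (hb y)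
  neg_mem' := fun {a} ha y => by simpa using neg_mem (ha y)

open Classical in
/-- characteristic function of a clopen set, in the patch algebra -/
noncomputable def patchChar {R : Type*} [CommRing R] {Y : Type*} [TopologicalSpace Y]
    (f : Y → Subring R) {U : Set Y} (hU : IsClopen U) : patchAlgebra Y R f :=
  ⟨LocallyConstant.charFn R hU, fun y => by
    rw [LocallyConstant.coe_charFn]
    by_cases h : y ∈ U
    · simpa [h] using one_mem (f y)
    · simpa [h] using zero_mem (f y)⟩

theorem patchChar_of_mem {R : Type*} [CommRing R] {Y : Type*} [TopologicalSpace Y]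
    (f : Y → Subring R) {U : Set Y} (hU : IsClopen U) {y : Y} (h : y ∈ U) :
    (patchChar f hU : LocallyConstant Y R) y = 1 := by
  simp [patchChar, LocallyConstant.coe_charFn, h]

theorem patchChar_of_notMem {R : Type*} [CommRing R] {Y : Type*} [TopologicalSpace Y]
    (f : Y → Subring R) {U : Set Y} (hU : IsClopen U) {y : Y} (h : y ∉ U) :
    (patchChar f hU : LocallyConstant Y R) y = 0 := by
  simp [patchChar, LocallyConstant.coe_charFn, h]

/-- evaluation at a point -/
def patchEval {R : Type*} [CommRing R] {Y : Type*} [TopologicalSpace Y]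
    (f : Y → Subring R) (y : Y) : patchAlgebra Y R f →+* R where
  toFun a := (a : LocallyConstant Y R) y
  map_zero' := rfl
  map_one' := rfl
  map_add' _ _ := rfl
  map_mul' _ _ := rfl

theorem exists_patchEval_ker_le {R : Type*} [CommRing R] {Y : Type*} [TopologicalSpace Y]
    [CompactSpace Y] (f : Y → Subring R) (q : Ideal (patchAlgebra Y R f)) (hq : q.IsPrime) :
    ∃ y, RingHom.ker (patchEval f y) ≤ q := by
  by_contra! hcon
  have key : ∃ a ∈ q, ∀ x ∈ (Set.univ : Set Y), (a : LocallyConstant Y R) x = 1 := by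
    refine isCompact_univ.induction_on
      (p := fun s => ∃ a ∈ q, ∀ x ∈ s, (a : LocallyConstant Y R) x = 1) ?_ ?_ ?_ ?_
    · exact ⟨0, q.zero_mem, by simp⟩
    · rintro s t hst ⟨a, ha, h⟩
      exact ⟨a, ha, fun x hx => h x (hst hx)⟩
    · rintro s t ⟨a, ha, hs⟩ ⟨b, hb, ht⟩
      refine ⟨a + b - a * b, q.sub_mem (q.add_mem ha hb) (q.mul_mem_left a hb), ?_⟩
      intro x hx
      change (a : LocallyConstant Y R) x + (b : LocallyConstant Y R) x
        - (a : LocallyConstant Y R) x * (b : LocallyConstant Y R) x = 1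
      rcases hx with hx | hx
      · rw [hs x hx]; ring
      · rw [ht x hx]; ring
    · intro y _
      obtain ⟨a, ha, haq⟩ := SetLike.not_le_iff_exists.1 (hcon y)
      have hU : IsClopen {x | (a : LocallyConstant Y R) x = 0} :=
        (a : LocallyConstant Y R).isLocallyConstant.isClopen_fiber 0
      refine ⟨_, mem_nhdsWithin_of_mem_nhds (hU.isOpen.mem_nhds ha), patchChar f hU, ?_,
        fun x hx => patchChar_of_mem f hU hx⟩
      have h0 : patchChar f hU * a = 0 := by
        apply Subtype.ext
        ext x
        change (patchChar f hU : LocallyConstant Y R) x * (a : LocallyConstant Y R) x = 0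
        by_cases hx : (a : LocallyConstant Y R) x = 0
        · rw [hx, mul_zero]
        · rw [patchChar_of_notMem f hU hx, zero_mul]
      exact (hq.mem_or_mem (h0 ▸ q.zero_mem)).resolve_right haq
  obtain ⟨a, ha, h⟩ := key
  have : a = 1 := by
    apply Subtype.ext
    ext x
    exact h x trivial
  exact hq.ne_top ((Ideal.eq_top_iff_one q).2 (this ▸ ha))

theorem eq_of_patchEval_ker_le {R : Type*} [CommRing R] [IsDomain R]
    {Y : Type*} [TopologicalSpace Y] [CompactSpace Y] [T2Space Y]
    [TotallyDisconnectedSpace Y] (f : Y → Subring R) {y z : Y}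
    (h : RingHom.ker (patchEval f y) ≤ RingHom.ker (patchEval f z)) : y = z := by
  by_contra hne
  obtain ⟨U, hU, hz, hy⟩ := exists_isClopen_of_totally_separated (Ne.symm hne)
  have h1 : (patchChar f hU : LocallyConstant Y R) z = 0 :=
    @h (patchChar f hU) (patchChar_of_notMem f hU hy)
  rw [patchChar_of_mem f hU hz] at h1
  exact one_ne_zero h1

/-- Let `R` be an integral domain, `Y` a Stone space, `f : Y → Σ(R)` continuous for the
Zariski topology, and `A` the patch algebra of the patch bundle `f`.  An ideal `p` of
`A` is a minimal prime ideal of `A` if and only if there is `y ∈ Y` such that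
`p = {a ∈ A | a y = 0}`. -/
theorem patchAlgebra_minimalPrimes (R : Type*) [CommRing R] [IsDomain R]
    (Y : Type*) [TopologicalSpace Y] [CompactSpace Y] [T2Space Y]
    [TotallyDisconnectedSpace Y] (f : Y → Subring R) (hf : Continuous f)
    (p : Ideal (patchAlgebra Y R f)) :
    p ∈ minimalPrimes (patchAlgebra Y R f) ↔
      ∃ y : Y, (p : Set (patchAlgebra Y R f)) =
        {a : patchAlgebra Y R f | (a : LocallyConstant Y R) y = 0} := by
  have hiff : ∀ y : Y, ((p : Set (patchAlgebra Y R f)) =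
        {a : patchAlgebra Y R f | (a : LocallyConstant Y R) y = 0}) ↔
        p = RingHom.ker (patchEval f y) := fun y =>
    ⟨fun h => SetLike.coe_injective h, fun h => by rw [h]; rfl⟩
  simp only [hiff]
  rw [minimalPrimes_eq_minimals]
  constructor
  · intro hp
    obtain ⟨y, hy⟩ := exists_patchEval_ker_le f p hp.prop
    exact ⟨y, le_antisymm (hp.le_of_le (RingHom.ker_isPrime _) hy) hy⟩
  · rintro ⟨y, rfl⟩
    refine ⟨RingHom.ker_isPrime _, fun q hq hle => ?_⟩
    obtain ⟨z, hz⟩ := exists_patchEval_ker_le f q hq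
    obtain rfl := eq_of_patchEval_ker_le f (hz.trans hle)
    exact hz
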